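/- arXiv:1603.08686 — 3 statements merged into one kernel-verified Lean document; each statement's English description precedes it below -/
import Mathlib

section
/- For every n ∈ ℕ, for every choice of nodes x_{n,1},…,x_{n,n} ∈ ℝ and measurable mappings φ_n : ℝ^{ℕ₀×{1,…,n}} → ℝ, and for every sequence (ε_n)_{n∈ℕ} of positive reals with lim_{n→∞} ε_n = 0, there exist c ∈ (0,∞), a strictly increasing continuous function u : [0,∞) → [0,∞), and a sequence of infinitely differentiable functions f_n : ℝ → ℝ with sup_x |f_n(x)| ≤ 1 and |f_n'(x)| ≤ 1 + u(|x|) for all x ∈ ℝ, such that for every n ∈ ℕ: |(2π)^{-1/2}∫_ℝ f_n(x)·exp(−x²/2) dx − φ_n((f_n^{(k)}(x_{n,1}),…,f_n^{(k)}(x_{n,n}))_{k∈ℕ₀})| ≥ c·ε_n. -/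
open MeasureTheory

lemma bump_exists (m n : ℕ) (x : Fin n → ℝ) :
    ∃ g : ℝ → ℝ, ∃ D : ℝ, ContDiff ℝ (⊤ : ℕ∞) g ∧ (∀ y, |g y| ≤ 1) ∧ 0 ≤ D ∧
      (∀ y, |deriv g y| ≤ D) ∧ (∀ y, y ≤ (m : ℝ) + 1 → deriv g y = 0) ∧
      (∀ k i, iteratedDeriv k g (x i) = 0) ∧
      Real.exp (-((m : ℝ) + 2) ^ 2 / 2) / 2 ≤ ∫ y : ℝ, g y * Real.exp (-y ^ 2 / 2) := by
  set U : Set ℝ := Set.Ioo ((m : ℝ) + 1) (m + 2) \ Set.range x with hU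
  have hfin : (Set.range x).Finite := Set.finite_range x
  have hUo : IsOpen U := isOpen_Ioo.sdiff hfin.isClosed
  have hvol : volume U = 1 := by
    rw [hU, measure_sdiff_null (hfin.measure_zero _), Real.volume_Ioo]
    norm_num
  obtain ⟨K, hKU, hK, hKv⟩ := hUo.measurableSet.exists_lt_isCompact (μ := volume)
    (r := ENNReal.ofReal (1/2)) (by
      rw [hvol, ← ENNReal.ofReal_one]
      exact (ENNReal.ofReal_lt_ofReal_iff one_pos).2 (by norm_num))
  obtain ⟨g, hg0, hg1, hg⟩ := exists_contMDiffMap_zero_one_nhds_of_isClosed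
    (n := (⊤ : ℕ∞)) (modelWithCornersSelf ℝ ℝ)
    hUo.isClosed_compl hK.isClosed (Set.disjoint_left.2 fun y h1 h2 => h1 (hKU h2))
  have hgs : ContDiff ℝ (⊤ : ℕ∞) (g : ℝ → ℝ) := g.contMDiff.contDiff
  have hz : ∀ y, y ∉ U → (g : ℝ → ℝ) =ᶠ[nhds y] fun _ => 0 := by
    intro y hy
    exact (eventually_nhdsSet_iff_forall.1 hg0) y hy
  have hgz : ∀ y, y ∉ U → g y = 0 := fun y hy => (hz y hy).eq_of_nhds
  have hg1' : ∀ y ∈ K, g y = 1 := fun y hy => hg1.self_of_nhdsSet y hy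
  have hcs : HasCompactSupport (g : ℝ → ℝ) := by
    refine HasCompactSupport.of_support_subset_isCompact
      (isCompact_Icc (a := (m : ℝ) + 1) (b := m + 2)) ?_
    intro y hy
    by_contra h
    exact hy (hgz y fun h' => h ⟨h'.1.1.le, h'.1.2.le⟩)
  have hdc : Continuous (deriv (g : ℝ → ℝ)) := hgs.continuous_deriv (by simp)
  obtain ⟨D, hD⟩ := hdc.bounded_above_of_compact_support hcs.deriv
  refine ⟨g, D, hgs, fun y => ?_, (norm_nonneg _).trans (hD 0), hD, fun y hy => ?_,
    fun k i => ?_, ?_⟩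
  · rw [abs_of_nonneg (hg y).1]; exact (hg y).2
  · rw [(hz y (fun h => absurd h.1.1 (not_lt.2 hy))).deriv_eq]; simp
  · rw [(hz (x i) (fun h => h.2 ⟨i, rfl⟩)).iteratedDeriv_eq k]
    simp
  · have hc : Continuous fun y : ℝ => g y * Real.exp (-y ^ 2 / 2) := by
      have := hgs.continuous
      fun_prop
    have hint : Integrable (fun y : ℝ => g y * Real.exp (-y ^ 2 / 2)) :=
      hc.integrable_of_hasCompactSupport hcs.mul_right
    have hKfin : volume K ≠ ⊤ := hK.measure_lt_top.ne
    have h1 : (1/2 : ℝ) ≤ volume.real K := by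
      rw [Measure.real]
      exact (ENNReal.ofReal_le_iff_le_toReal hKfin).1 hKv.le
    calc Real.exp (-((m : ℝ) + 2) ^ 2 / 2) / 2
        ≤ volume.real K * Real.exp (-((m : ℝ) + 2) ^ 2 / 2) := by
          nlinarith [Real.exp_pos (-((m : ℝ) + 2) ^ 2 / 2)]
      _ = ∫ y in K, Real.exp (-((m : ℝ) + 2) ^ 2 / 2) := by simp
      _ ≤ ∫ y in K, g y * Real.exp (-y ^ 2 / 2) := by
          refine setIntegral_mono_on (integrableOn_const hKfin) hint.integrableOn
            hK.measurableSet ?_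
          intro y hy
          rw [hg1' y hy, one_mul]
          apply Real.exp_le_exp.2
          have h2 := (hKU hy).1
          have h3 : (0 : ℝ) ≤ m := m.cast_nonneg
          nlinarith [h2.1, h2.2]
      _ ≤ ∫ y : ℝ, g y * Real.exp (-y ^ 2 / 2) :=
          setIntegral_le_integral hint
            (Filter.Eventually.of_forall fun y => mul_nonneg (hg y).1 (Real.exp_pos _).le)

lemma majorant_exists (m : ℕ → ℕ) (hm : Filter.Tendsto m Filter.atTop Filter.atTop)
    (D : ℕ → ℝ) (hD : ∀ n, 0 ≤ D n) :
    ∃ u : ℝ → ℝ, StrictMono u ∧ Continuous u ∧ (∀ y ≥ (0:ℝ), 0 ≤ u y) ∧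
      ∀ n y, (m n : ℝ) + 1 ≤ y → D n ≤ u y := by
  have hfin : ∀ z : ℝ, {n | (m n : ℝ) < z}.Finite := by
    intro z
    have h := (tendsto_natCast_atTop_atTop (R := ℝ)).comp hm
    have h2 := h.eventually_ge_atTop z
    rw [← Nat.cofinite_eq_atTop, Filter.eventually_cofinite] at h2
    simpa using h2
  have hsupp : ∀ y z : ℝ, y ≤ z →
      (Function.support fun n => D n * max 0 (y - m n)) ⊆ {n | (m n : ℝ) < z} := by
    intro y z hyz n hn
    by_contra h
    apply hn
    have : y - m n ≤ 0 := by
      have : z ≤ m n := not_lt.1 h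
      linarith
    simp [max_eq_left this]
  have hfs : ∀ y : ℝ, (Function.support fun n => D n * max 0 (y - m n)).Finite :=
    fun y => (hfin y).subset (hsupp y y le_rfl)
  have hnn : ∀ (y : ℝ) n, 0 ≤ D n * max 0 (y - m n) :=
    fun y n => mul_nonneg (hD n) (le_max_left _ _)
  refine ⟨fun y => y + ∑ᶠ n, D n * max 0 (y - m n), ?_, ?_, ?_, ?_⟩
  · intro a b hab
    refine add_lt_add_of_lt_of_le hab (finsum_le_finsum' (hfs a) (hfs b) fun n => ?_)
    exact mul_le_mul_of_nonneg_left (max_le_max le_rfl (by linarith)) (hD n)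
  · refine continuous_id.add (continuous_finsum (fun n => by fun_prop) ?_)
    intro y
    refine ⟨Set.Iio (y + 1), Iio_mem_nhds (by linarith), (hfin (y + 1)).subset ?_⟩
    rintro n ⟨z, hz, hz'⟩
    exact hsupp z (y + 1) (le_of_lt hz') hz
  · intro y hy
    exact add_nonneg hy (finsum_nonneg (hnn y))
  · intro n y hy
    have h1 := single_le_finsum n (hfs y) (hnn y)
    have h2 : D n ≤ D n * max 0 (y - m n) :=
      le_mul_of_one_le_right (hD n) (le_max_of_le_right (by linarith))
    have h3 : (0:ℝ) ≤ m n := Nat.cast_nonneg _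
    show D n ≤ y + _
    linarith

/-- For every choice of nodes `x n 1, …, x n n` and measurable mappings
`φ n : ℝ^(ℕ₀ × {1,…,n}) → ℝ`, and for every sequence of positive reals `ε n → 0`,
there exist `c ∈ (0,∞)`, a strictly increasing continuous `u : [0,∞) → [0,∞)` and
smooth functions `f n : ℝ → ℝ` with `|f n| ≤ 1` and `|(f n)'(x)| ≤ 1 + u |x|` such that
for every `n` the quadrature error at the standard normal distribution is at least `c * ε n`. -/
theorem statement0
    (x : (n : ℕ) → Fin n → ℝ)
    (φ : (n : ℕ) → ((ℕ × Fin n → ℝ) → ℝ))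
    (hφ : ∀ n, Measurable (φ n))
    (ε : ℕ → ℝ) (hε : ∀ n, 0 < ε n)
    (hε0 : Filter.Tendsto ε Filter.atTop (nhds 0)) :
    ∃ c : ℝ, 0 < c ∧
    ∃ u : ℝ → ℝ,
      StrictMonoOn u (Set.Ici 0) ∧ ContinuousOn u (Set.Ici 0) ∧ (∀ y ≥ (0:ℝ), 0 ≤ u y) ∧
    ∃ f : ℕ → ℝ → ℝ,
      (∀ n, ContDiff ℝ (⊤ : ℕ∞) (f n)) ∧
      (∀ n y, |f n y| ≤ 1) ∧
      (∀ n y, |deriv (f n) y| ≤ 1 + u |y|) ∧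
      ∀ n, c * ε n ≤
        |(Real.sqrt (2 * Real.pi))⁻¹ * (∫ y : ℝ, f n y * Real.exp (-y ^ 2 / 2))
          - φ n (fun p => iteratedDeriv p.1 (f n) (x n p.2))| := by
  have hs : 0 < (Real.sqrt (2 * Real.pi))⁻¹ := by positivity
  set h : ℕ → ℝ := fun m =>
    (Real.sqrt (2 * Real.pi))⁻¹ * (Real.exp (-((m : ℝ) + 2) ^ 2 / 2) / 2) with hh
  have hpos : ∀ m, 0 < h m := fun m => by positivity
  obtain ⟨M, hM⟩ := hε0.bddAbove_range
  have hM' : ∀ n, ε n ≤ M := fun n => hM ⟨n, rfl⟩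
  have hMpos : 0 < M := (hε 0).trans_le (hM' 0)
  set c := h 0 / M with hc
  have hcpos : 0 < c := div_pos (hpos 0) hMpos
  have hP0 : ∀ n, c * ε n ≤ h 0 := fun n => by
    calc c * ε n ≤ c * M := mul_le_mul_of_nonneg_left (hM' n) hcpos.le
      _ = h 0 := by rw [hc]; field_simp
  classical
  set m : ℕ → ℕ := fun n => Nat.findGreatest (fun k => c * ε n ≤ h k) n with hm
  have hmP : ∀ n, c * ε n ≤ h (m n) := fun n =>
    Nat.findGreatest_spec (P := fun k => c * ε n ≤ h k) (Nat.zero_le n) (hP0 n)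
  have hmt : Filter.Tendsto m Filter.atTop Filter.atTop := by
    refine Filter.tendsto_atTop.2 fun k => ?_
    have h1 : Filter.Tendsto (fun n => c * ε n) Filter.atTop (nhds 0) := by
      simpa using hε0.const_mul c
    filter_upwards [h1.eventually_le_const (hpos k), Filter.eventually_ge_atTop k] with n h2 h3
    exact Nat.le_findGreatest h3 h2
  choose g D hg1 hg2 hg3 hg4 hg5 hg6 hg7 using fun n => bump_exists (m n) n (x n)
  obtain ⟨u, hu1, hu2, hu3, hu4⟩ := majorant_exists m hmt D hg3
  set I : ℕ → ℝ := fun n =>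
    (Real.sqrt (2 * Real.pi))⁻¹ * (∫ y : ℝ, g n y * Real.exp (-y ^ 2 / 2)) with hI
  have hIge : ∀ n, c * ε n ≤ I n := fun n =>
    (hmP n).trans (mul_le_mul_of_nonneg_left (hg7 n) hs.le)
  have hder : ∀ n y, |deriv (g n) y| ≤ 1 + u |y| := by
    intro n y
    have h0 := hu3 |y| (abs_nonneg y)
    rcases le_or_gt y ((m n : ℝ) + 1) with hy | hy
    · rw [hg5 n y hy, abs_zero]; linarith
    · have := hu4 n |y| (hy.le.trans (le_abs_self y))
      linarith [hg4 n y]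
  refine ⟨c, hcpos, u, hu1.strictMonoOn _, hu2.continuousOn, hu3, ?_⟩
  set a : ℕ → ℝ := fun n => φ n (fun _ => 0) with ha
  have key : ∀ n, ∃ f : ℝ → ℝ, ContDiff ℝ (⊤ : ℕ∞) f ∧ (∀ y, |f y| ≤ 1) ∧
      (∀ y, |deriv f y| ≤ 1 + u |y|) ∧ c * ε n ≤
        |(Real.sqrt (2 * Real.pi))⁻¹ * (∫ y : ℝ, f y * Real.exp (-y ^ 2 / 2))
          - φ n (fun p => iteratedDeriv p.1 f (x n p.2))| := by
    intro n
    rcases le_total (a n) 0 with han | han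
    · refine ⟨g n, hg1 n, hg2 n, hder n, ?_⟩
      have e : (fun p : ℕ × Fin n => iteratedDeriv p.1 (g n) (x n p.2)) = fun _ => 0 :=
        funext fun p => hg6 n p.1 p.2
      rw [e]
      refine le_trans ?_ (le_abs_self _)
      change c * ε n ≤ I n - a n
      linarith [hIge n]
    · refine ⟨fun y => - g n y, (hg1 n).neg, fun y => by simpa using hg2 n y,
        fun y => by simpa [deriv.fun_neg] using hder n y, ?_⟩
      have e : (fun p : ℕ × Fin n => iteratedDeriv p.1 (fun y => - g n y) (x n p.2))
          = fun _ => 0 := by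
        funext p
        rw [iteratedDeriv_fun_neg, hg6 n p.1 p.2, neg_zero]
      rw [e]
      refine le_trans ?_ (neg_le_abs _)
      simp only [neg_mul, integral_neg, mul_neg]
      change c * ε n ≤ -(-I n - a n)
      linarith [hIge n]
  choose f hf1 hf2 hf3 hf4 using key
  exact ⟨f, hf1, hf2, hf3, hf4⟩
end

section
/- Let u : [0,∞) → [0,∞) be strictly increasing and continuous with lim_{x→∞} u(x) = ∞, let H_u = {h ∈ C^∞(ℝ;ℝ) : |h'(x)| ≤ 1 + u(|x|) for all x}, let n ∈ ℕ and put z_n = max(n, u(0)). Then there exist functions h_{1,+}, h_{1,−}, …, h_{2n,+}, h_{2n,−} ∈ H_u with the following properties: (i) for every i = 1,…,2n, {h_{i,+} ≠ 0} ∪ {h_{i,−} ≠ 0} = (u^{-1}(z_n) + (i−1)/n, u^{-1}(z_n) + i/n); (ii) for all sign patterns δ_1,…,δ_{2n} ∈ {+,−}, ∑_{i=1}^{2n} h_{i,δ_i} ∈ H_u and ∫_ℝ sin(∑_{i=1}^{2n} h_{i,δ_i}(x)) dx = ∑_{i=1}^{2n} ∫_ℝ sin(h_{i,δ_i}(x))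 dx; (iii) for every i = 1,…,2n, ∫_ℝ sin(h_{i,+}(x))·exp(−x²/2) dx ≥ (sin(1/12)·e^{−4}/3)·exp(−(u^{-1}(z_n))²)/n. -/
open MeasureTheory

/-- The class `H_u` of smooth functions whose derivative is dominated by `1 + u (|·|)`. -/
def Hu (u : ℝ → ℝ) : Set (ℝ → ℝ) :=
  {h | ContDiff ℝ (⊤ : ℕ∞) h ∧ ∀ y, |deriv h y| ≤ 1 + u |y|}

noncomputable def bmp (t : ℝ) : ℝ := 8 * (expNegInvGlue t * expNegInvGlue (1 - t))

lemma bmp_contDiff : ContDiff ℝ (⊤ : ℕ∞) bmp := by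
  unfold bmp
  exact contDiff_const.mul (expNegInvGlue.contDiff.mul
    (expNegInvGlue.contDiff.comp (contDiff_const.sub contDiff_id)))

lemma bmp_nonneg (t : ℝ) : 0 ≤ bmp t := by
  have := expNegInvGlue.nonneg t
  have := expNegInvGlue.nonneg (1 - t)
  unfold bmp; positivity

lemma bmp_zero {t : ℝ} (h : t ∉ Set.Ioo (0 : ℝ) 1) : bmp t = 0 := by
  unfold bmp
  by_cases h0 : t ≤ 0
  · simp [expNegInvGlue.zero_of_nonpos h0]
  · have h1 : 1 - t ≤ 0 := by
      by_contra h1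
      exact h ⟨by linarith, by linarith⟩
    simp [expNegInvGlue.zero_of_nonpos h1]

lemma bmp_eq {t : ℝ} (h : t ∈ Set.Ioo (0 : ℝ) 1) :
    bmp t = 8 * Real.exp (-(t * (1 - t))⁻¹) := by
  obtain ⟨h0, h1⟩ := h
  have h2 : 0 < 1 - t := by linarith
  unfold bmp expNegInvGlue
  rw [if_neg (by linarith), if_neg (by linarith), ← Real.exp_add]
  congr 2
  field_simp
  ring

lemma bmp_ne {t : ℝ} : bmp t ≠ 0 ↔ t ∈ Set.Ioo (0 : ℝ) 1 := by
  constructor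
  · intro h
    by_contra h'
    exact h (bmp_zero h')
  · intro h
    rw [bmp_eq h]
    positivity

lemma bmp_le (t : ℝ) : bmp t ≤ 1 := by
  by_cases h : t ∈ Set.Ioo (0 : ℝ) 1
  · rw [bmp_eq h]
    have hp : 0 < t * (1 - t) := mul_pos h.1 (by linarith [h.2])
    have h4 : 4 ≤ (t * (1 - t))⁻¹ := by
      rw [le_inv_comm₀ (by norm_num) hp]
      nlinarith [sq_nonneg (2 * t - 1)]
    have h5 : Real.exp (-(t * (1 - t))⁻¹) ≤ Real.exp (-4) := Real.exp_le_exp.2 (by linarith)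
    have h6 := Real.quadratic_le_exp_of_nonneg (x := 4) (by norm_num)
    have h7 : Real.exp (-4) * Real.exp 4 = 1 := by rw [← Real.exp_add]; norm_num
    nlinarith [Real.exp_pos (-4)]
  · rw [bmp_zero h]; norm_num

lemma bmp_ge {t : ℝ} (h : t ∈ Set.Icc (1 / 3 : ℝ) (2 / 3)) : 1 / 12 ≤ bmp t := by
  obtain ⟨h0, h1⟩ := h
  rw [bmp_eq ⟨by linarith, by linarith⟩]
  have hp : 2 / 9 ≤ t * (1 - t) := by nlinarith
  have h4 : (t * (1 - t))⁻¹ ≤ 9 / 2 := by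
    rw [inv_le_comm₀ (by linarith) (by norm_num)]
    norm_num; linarith
  have h5 : Real.exp (-(9 / 2)) ≤ Real.exp (-(t * (1 - t))⁻¹) := Real.exp_le_exp.2 (by linarith)
  have h6 : Real.exp (9 / 2) ≤ 96 := by
    have e1 : Real.exp (9 / 2) ^ 2 = Real.exp 1 ^ 9 := by
      rw [← Real.exp_nat_mul, ← Real.exp_nat_mul]; norm_num
    have e2 : Real.exp 1 ^ 9 ≤ 2.72 ^ 9 :=
      pow_le_pow_left₀ (Real.exp_pos _).le (by linarith [Real.exp_one_lt_d9]) 9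
    have e3 : (2.72 : ℝ) ^ 9 ≤ 96 ^ 2 := by norm_num
    exact (sq_le_sq₀ (Real.exp_pos _).le (by norm_num)).1 (by linarith)
  have h7 : Real.exp (-(9 / 2)) * Real.exp (9 / 2) = 1 := by rw [← Real.exp_add]; norm_num
  nlinarith [Real.exp_pos (-(9 / 2))]

lemma bmp_deriv_zero {t : ℝ} (h : t ∉ Set.Ioo (0 : ℝ) 1) : deriv bmp t = 0 := by
  apply IsLocalMin.deriv_eq_zero
  refine Filter.Eventually.of_forall fun y => ?_
  rw [bmp_zero h]; exact bmp_nonneg y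

lemma exp_aux {w : ℝ} (hw : 4 ≤ w) : 64 * (w ^ 3 * (w - 4)) * Real.exp (-w) ^ 2 ≤ 1 := by
  obtain ⟨s, rfl⟩ : ∃ s, w = 4 + s := ⟨w - 4, by ring⟩
  have hs : 0 ≤ s := by linarith
  have h1 := Real.quadratic_le_exp_of_nonneg hs
  have h2 : 53 ≤ Real.exp 4 := by
    have e1 : Real.exp 4 = Real.exp 1 ^ 4 := by
      rw [← Real.exp_nat_mul]; norm_num
    have e2 : (2.7 : ℝ) ^ 4 ≤ Real.exp 1 ^ 4 :=
      pow_le_pow_left₀ (by norm_num) (by linarith [Real.exp_one_gt_d9]) 4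
    norm_num at e2
    linarith
  have h3 : 53 * (1 + s + s ^ 2 / 2) ≤ Real.exp (4 + s) := by
    rw [Real.exp_add]
    exact mul_le_mul h2 h1 (by positivity) (by positivity)
  have h4 : (53 * (1 + s + s ^ 2 / 2)) ^ 2 ≤ Real.exp (4 + s) ^ 2 :=
    pow_le_pow_left₀ (by positivity) h3 2
  have h5 : 64 * ((4 + s) ^ 3 * (4 + s - 4)) ≤ Real.exp (4 + s) ^ 2 := by
    refine le_trans ?_ h4
    have := pow_nonneg hs 2
    have := pow_nonneg hs 3
    have := pow_nonneg hs 4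
    nlinarith
  rw [Real.exp_neg, inv_pow, ← div_eq_mul_inv, div_le_one (by positivity)]
  exact h5

lemma bmp_deriv (t : ℝ) : |deriv bmp t| ≤ 1 := by
  by_cases h : t ∈ Set.Ioo (0 : ℝ) 1
  · have hev : bmp =ᶠ[nhds t] fun t => 8 * Real.exp (-(t * (1 - t))⁻¹) := by
      filter_upwards [isOpen_Ioo.mem_nhds h] with y hy using bmp_eq hy
    rw [hev.deriv_eq]
    have hp : 0 < t * (1 - t) := mul_pos h.1 (by linarith [h.2])
    have h4 : 4 ≤ (t * (1 - t))⁻¹ := by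
      rw [le_inv_comm₀ (by norm_num) hp]
      nlinarith [sq_nonneg (2 * t - 1)]
    have hd : HasDerivAt (fun t : ℝ => t * (1 - t)) (1 * (1 - t) + t * (-1)) t :=
      (hasDerivAt_id t).mul ((hasDerivAt_id t).const_sub 1)
    have hd2 := ((hd.fun_inv hp.ne').fun_neg.exp).const_mul 8
    rw [hd2.deriv]
    have key := exp_aux h4
    refine (sq_le_one_iff_abs_le_one _).1 (le_trans (le_of_eq ?_) key)
    generalize Real.exp _ = E
    have : t ≠ 0 := h.1.ne'
    have : 1 - t ≠ 0 := by linarith [h.2]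
    field_simp
    ring
  · rw [bmp_deriv_zero h]; norm_num

lemma sum_single_aux {N : ℕ} (f : ℝ → ℝ) (f0 : f 0 = 0) (g : Fin N → ℝ)
    (hg : ∀ i j, g i ≠ 0 → g j ≠ 0 → i = j) : f (∑ i, g i) = ∑ i, f (g i) := by
  by_cases h : ∃ i, g i ≠ 0
  · obtain ⟨i, hi⟩ := h
    have hj : ∀ j, j ≠ i → g j = 0 := fun j hji => by
      by_contra hj
      exact hji (hg j i hj hi)
    rw [Finset.sum_eq_single i (fun j _ hji => hj j hji) (by simp),
      Finset.sum_eq_single i (fun j _ hji => by rw [hj j hji, f0]) (by simp)]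
  · push Not at h
    simp [h, f0]

noncomputable def hfun (n : ℕ) (a : ℝ) (i : ℕ) (s : Bool) (x : ℝ) : ℝ :=
  (if s then 1 else -1) * bmp (n * (x - a) - i)

lemma hfun_contDiff (n : ℕ) (a : ℝ) (i : ℕ) (s : Bool) :
    ContDiff ℝ (⊤ : ℕ∞) (hfun n a i s) := by
  unfold hfun
  exact contDiff_const.mul (bmp_contDiff.comp
    ((contDiff_const.mul (contDiff_id.sub contDiff_const)).sub contDiff_const))

lemma hfun_deriv (n : ℕ) (a : ℝ) (i : ℕ) (s : Bool) (x : ℝ) :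
    deriv (hfun n a i s) x = (if s then 1 else -1) * (deriv bmp (n * (x - a) - i) * n) := by
  have h1 : HasDerivAt (fun x : ℝ => (n : ℝ) * (x - a) - i) (n * 1) x :=
    (((hasDerivAt_id x).sub_const a).const_mul (n : ℝ)).sub_const (i : ℝ)
  have h2 : HasDerivAt bmp (deriv bmp (n * (x - a) - i)) (n * (x - a) - i) :=
    ((bmp_contDiff.differentiable (by simp)) _).hasDerivAt
  have h3 := (h2.comp x h1).const_mul (if s then (1 : ℝ) else -1)
  rw [mul_one] at h3
  exact h3.deriv

lemma ioo_iff {n : ℕ} (hn : 0 < n) (a x : ℝ) (i : ℕ) :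
    n * (x - a) - i ∈ Set.Ioo (0 : ℝ) 1 ↔
      x ∈ Set.Ioo (a + (i : ℕ) / (n : ℝ)) (a + ((i : ℕ) + 1) / (n : ℝ)) := by
  have hn' : (0 : ℝ) < n := by exact_mod_cast hn
  rw [Set.mem_Ioo, Set.mem_Ioo, ← lt_sub_iff_add_lt', ← sub_lt_iff_lt_add', div_lt_iff₀ hn',
    lt_div_iff₀ hn']
  constructor <;> rintro ⟨h1, h2⟩ <;> constructor <;> linarith

lemma hfun_ne {n : ℕ} {a : ℝ} {i : ℕ} {s : Bool} {x : ℝ} :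
    hfun n a i s x ≠ 0 ↔ n * (x - a) - i ∈ Set.Ioo (0 : ℝ) 1 := by
  rw [← bmp_ne]
  unfold hfun
  cases s <;> simp

lemma hfun_deriv_ne {n : ℕ} {a : ℝ} {i : ℕ} {s : Bool} {x : ℝ}
    (h : deriv (hfun n a i s) x ≠ 0) : n * (x - a) - i ∈ Set.Ioo (0 : ℝ) 1 := by
  by_contra h'
  apply h
  rw [hfun_deriv, bmp_deriv_zero h']; simp

lemma idx_unique {y : ℝ} {i j : ℕ} (hi : y - i ∈ Set.Ioo (0 : ℝ) 1)
    (hj : y - j ∈ Set.Ioo (0 : ℝ) 1) : i = j := by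
  have h1 : (i : ℝ) < j + 1 := by linarith [hi.1, hj.2]
  have h2 : (j : ℝ) < i + 1 := by linarith [hj.1, hi.2]
  have h1' : i < j + 1 := by exact_mod_cast h1
  have h2' : j < i + 1 := by exact_mod_cast h2
  omega

lemma hfun_deriv_abs_le (n : ℕ) (a : ℝ) (i : ℕ) (s : Bool) (x : ℝ) :
    |deriv (hfun n a i s) x| ≤ n := by
  rw [hfun_deriv, abs_mul, abs_mul]
  have h1 : |(if s then (1 : ℝ) else -1)| = 1 := by cases s <;> simp
  rw [h1, one_mul, Nat.abs_cast]
  have := bmp_deriv (n * (x - a) - i)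
  have hn : (0 : ℝ) ≤ n := Nat.cast_nonneg n
  nlinarith

lemma hfun_compact {n : ℕ} (hn : 0 < n) (a : ℝ) (i : ℕ) (s : Bool) :
    HasCompactSupport (hfun n a i s) := by
  apply HasCompactSupport.intro (isCompact_Icc (a := a + (i : ℕ) / (n : ℝ))
    (b := a + ((i : ℕ) + 1) / (n : ℝ)))
  intro x hx
  by_contra h
  exact hx (Set.Ioo_subset_Icc_self ((ioo_iff hn a x i).1 (hfun_ne.1 h)))

lemma hfun_sin_integrable {n : ℕ} (hn : 0 < n) (a : ℝ) (i : ℕ) (s : Bool) :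
    Integrable (fun x => Real.sin (hfun n a i s x)) := by
  apply Continuous.integrable_of_hasCompactSupport
  · exact Real.continuous_sin.comp (hfun_contDiff n a i s).continuous
  · exact (hfun_compact hn a i s).comp_left (g := Real.sin) Real.sin_zero

lemma hfun_int {n : ℕ} (hn : 0 < n) {a : ℝ} (ha0 : 0 ≤ a) (i : ℕ) (hi : i < 2 * n) :
    Real.sin (1 / 12) * Real.exp (-4) / 3 * (Real.exp (-a ^ 2) / n) ≤
        ∫ x : ℝ, Real.sin (hfun n a i true x) * Real.exp (-x ^ 2 / 2) := by
  have hn' : (0 : ℝ) < n := by exact_mod_cast hn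
  have hval : ∀ x, hfun n a i true x = bmp (n * (x - a) - i) := fun x => by simp [hfun]
  have hpi := Real.pi_gt_three
  have hnn : ∀ x, 0 ≤ Real.sin (hfun n a i true x) * Real.exp (-x ^ 2 / 2) := by
    intro x
    refine mul_nonneg ?_ (Real.exp_pos _).le
    rw [hval]
    exact Real.sin_nonneg_of_nonneg_of_le_pi (bmp_nonneg _) (by linarith [bmp_le (n * (x - a) - i)])
  have hint : Integrable (fun x => Real.sin (hfun n a i true x) * Real.exp (-x ^ 2 / 2)) := by
    apply Continuous.integrable_of_hasCompactSupport
    · have := (hfun_contDiff n a i true).continuous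
      fun_prop
    · exact ((hfun_compact hn a i true).comp_left (g := Real.sin) Real.sin_zero).mul_right
  set S := Set.Icc (a + (i + 1 / 3) / (n : ℝ)) (a + (i + 2 / 3) / (n : ℝ)) with hS
  have hconst : ∀ x ∈ S, Real.sin (1 / 12) * Real.exp (-4 + -a ^ 2) ≤
      Real.sin (hfun n a i true x) * Real.exp (-x ^ 2 / 2) := by
    intro x hx
    rw [hS, Set.mem_Icc, ← le_sub_iff_add_le', ← sub_le_iff_le_add', div_le_iff₀ hn',
      le_div_iff₀ hn'] at hx
    obtain ⟨h1, h2⟩ := hx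
    have hb := bmp_ge (t := n * (x - a) - i) ⟨by linarith, by linarith⟩
    have hb' := bmp_le (n * (x - a) - i)
    have hi' : (i : ℝ) + 1 ≤ 2 * n := by exact_mod_cast hi
    have hx0 : 0 ≤ x - a := by
      have hi0 : (0 : ℝ) ≤ i := Nat.cast_nonneg i
      by_contra hc
      push Not at hc
      nlinarith
    have hx2 : x - a ≤ 2 := by
      by_contra hc
      push Not at hc
      nlinarith
    rw [hval]
    apply mul_le_mul
    · exact Real.sin_le_sin_of_le_of_le_pi_div_two (by linarith) (by linarith) hb
    · apply Real.exp_le_exp.2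
      have : x ^ 2 ≤ (a + 2) ^ 2 := pow_le_pow_left₀ (by linarith) (by linarith) 2
      nlinarith [sq_nonneg (a - 2)]
    · exact (Real.exp_pos _).le
    · exact Real.sin_nonneg_of_nonneg_of_le_pi (by linarith) (by linarith)
  have hle : ∫ x in S, Real.sin (hfun n a i true x) * Real.exp (-x ^ 2 / 2) ≤
      ∫ x : ℝ, Real.sin (hfun n a i true x) * Real.exp (-x ^ 2 / 2) :=
    setIntegral_le_integral hint (Filter.Eventually.of_forall hnn)
  refine le_trans ?_ hle
  have hge : ∫ x in S, Real.sin (1 / 12) * Real.exp (-4 + -a ^ 2) ≤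
      ∫ x in S, Real.sin (hfun n a i true x) * Real.exp (-x ^ 2 / 2) :=
    setIntegral_mono_on (integrableOn_const (by rw [hS]; simp)) hint.integrableOn
      measurableSet_Icc hconst
  refine le_trans (le_of_eq ?_) hge
  have hvol : volume.real S = 1 / 3 / n := by
    rw [hS, Real.volume_real_Icc_of_le]
    · field_simp; ring
    · gcongr; norm_num
  rw [setIntegral_const, hvol, Real.exp_add, smul_eq_mul]
  field_simp

/-- for `u : [0,∞) → [0,∞)` strictly increasing and continuous with
`u(x) → ∞`, `n ∈ ℕ`, `z_n = max(n, u 0)` and `a = u⁻¹(z_n)` (encoded by `a ≥ 0`,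
`u a = max n (u 0)`), there exist functions `h i ±1 ∈ H_u` (indexed by `i : Fin (2n)`,
`true = +`, `false = -`) such that:
(i) `{h i + ≠ 0} ∪ {h i - ≠ 0} = (a + i/n, a + (i+1)/n)`;
(ii) every sign-pattern sum lies in `H_u` and the integral of its sine splits as the
sum of the integrals of the sines;
(iii) `∫ sin(h i +) exp(-x²/2) dx ≥ (sin(1/12) e⁻⁴ / 3) · exp(-a²)/n`. -/
theorem statement10
    (u : ℝ → ℝ)
    (hmono : StrictMonoOn u (Set.Ici 0)) (hcont : ContinuousOn u (Set.Ici 0))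
    (hnonneg : ∀ y ≥ (0:ℝ), 0 ≤ u y)
    (htop : Filter.Tendsto u Filter.atTop Filter.atTop)
    (n : ℕ) (hn : 0 < n)
    (a : ℝ) (ha0 : 0 ≤ a) (ha : u a = max (n : ℝ) (u 0)) :
    ∃ h : Fin (2 * n) → Bool → ℝ → ℝ,
      (∀ i s, h i s ∈ Hu u) ∧
      (∀ i, ({x | h i true x ≠ 0} ∪ {x | h i false x ≠ 0}) =
        Set.Ioo (a + (i : ℕ) / (n : ℝ)) (a + ((i : ℕ) + 1) / (n : ℝ))) ∧
      (∀ δs : Fin (2 * n) → Bool,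
        (fun x => ∑ i, h i (δs i) x) ∈ Hu u ∧
        (∫ x : ℝ, Real.sin (∑ i, h i (δs i) x)) =
          ∑ i, ∫ x : ℝ, Real.sin (h i (δs i) x)) ∧
      (∀ i, Real.sin (1 / 12) * Real.exp (-4) / 3 * (Real.exp (-a ^ 2) / n) ≤
        ∫ x : ℝ, Real.sin (h i true x) * Real.exp (-x ^ 2 / 2)) := by
  have hua : (n : ℝ) ≤ u a := ha ▸ le_max_left _ _
  have hux : ∀ x i, (n : ℝ) * (x - a) - (i : ℕ) ∈ Set.Ioo (0 : ℝ) 1 → (n : ℝ) ≤ u |x| := by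
    intro x i hx
    have hx' := ((ioo_iff hn a x i).1 hx).1
    have h0 : (0 : ℝ) ≤ (i : ℝ) / n := by positivity
    have hax : a ≤ x := by linarith
    rw [abs_of_nonneg (ha0.trans hax)]
    exact hua.trans (hmono.monotoneOn ha0 (Set.mem_Ici.2 (ha0.trans hax)) hax)
  have hd : ∀ i s x, |deriv (hfun n a i s) x| ≤ 1 + u |x| := by
    intro i s x
    by_cases h : deriv (hfun n a i s) x = 0
    · rw [h, abs_zero]; linarith [hnonneg |x| (abs_nonneg x)]
    · have h1 := hux x i (hfun_deriv_ne h)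
      have h2 := hfun_deriv_abs_le n a i s x
      linarith
  refine ⟨fun i s => hfun n a i s, fun i s => ⟨hfun_contDiff n a i s, hd i s⟩, ?_, ?_, ?_⟩
  · intro i
    ext x
    rw [← ioo_iff hn, Set.mem_union, Set.mem_ofPred_eq, Set.mem_ofPred_eq, hfun_ne, hfun_ne, or_self]
  · intro δs
    refine ⟨⟨ContDiff.sum fun i _ => hfun_contDiff n a i (δs i), ?_⟩, ?_⟩
    · intro x
      rw [deriv_fun_sum fun (i : Fin (2 * n)) _ =>
        ((hfun_contDiff n a i (δs i)).differentiable (by simp)) x]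
      rw [sum_single_aux (fun y => |y|) abs_zero _
        (fun i j hi hj => Fin.ext (idx_unique (hfun_deriv_ne hi) (hfun_deriv_ne hj)))]
      by_cases h : ∃ i : Fin (2 * n), deriv (hfun n a i (δs i)) x ≠ 0
      · obtain ⟨i, hi⟩ := h
        rw [Finset.sum_eq_single i]
        · exact hd i (δs i) x
        · intro j _ hji
          by_contra hj
          exact hji (Fin.ext (idx_unique (hfun_deriv_ne (abs_ne_zero.1 hj)) (hfun_deriv_ne hi)))
        · simp
      · push Not at h
        simp only [h, abs_zero, Finset.sum_const_zero]
        linarith [hnonneg |x| (abs_nonneg x)]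
    · rw [← integral_finsetSum _ fun (i : Fin (2 * n)) _ => hfun_sin_integrable hn a i (δs i)]
      congr 1
      ext x
      exact sum_single_aux Real.sin Real.sin_zero _
        (fun i j hi hj => Fin.ext (idx_unique (hfun_ne.1 hi) (hfun_ne.1 hj)))
  · intro i
    exact hfun_int hn ha0 i i.2
end

section
/- Let τ_1 < τ_2 and v_1 < v_2 be real numbers, and define θ_{τ1,τ2,v1,v2} : ℝ → ℝ by θ(x) = v_1 for x ≤ τ_1, θ(x) = v_1 + (v_2−v_1)/(1 + exp((τ_2−τ_1)/(x−τ_1) − (τ_2−τ_1)/(τ_2−x))) for τ_1 < x < τ_2, and θ(x) = v_2 for x ≥ τ_2. Then: (i) θ is infinitely differentiable with values in [v_1, v_2]; (ii) for every k ∈ ℕ, the k-th derivative of θ vanishes on ℝ \ (τ_1, τ_2); (iii) θ is strictly increasing on [τ_1, τ_2]; (iv) sup_x |θ'(x)| ≤ 4·(v_2−v_1)/(τ_2−τ_1). -/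
/-- The smooth transition function `θ_{τ1,τ2,v1,v2}`. -/
noncomputable def theta (τ1 τ2 v1 v2 : ℝ) (x : ℝ) : ℝ :=
  if x ≤ τ1 then v1
  else if x < τ2 then
    v1 + (v2 - v1) / (1 + Real.exp ((τ2 - τ1) / (x - τ1) - (τ2 - τ1) / (τ2 - x)))
  else v2

lemma theta_eq (τ1 τ2 v1 v2 : ℝ) (hτ : τ1 < τ2) (x : ℝ) :
    theta τ1 τ2 v1 v2 x =
      v1 + (v2 - v1) * Real.smoothTransition ((x - τ1) / (τ2 - τ1)) := by
  have hL : 0 < τ2 - τ1 := sub_pos.2 hτ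
  unfold theta
  split_ifs with h1 h2
  · rw [Real.smoothTransition.zero_of_nonpos]
    · ring
    · exact div_nonpos_of_nonpos_of_nonneg (by linarith) hL.le
  · push Not at h1
    have ha : 0 < x - τ1 := sub_pos.2 h1
    have hb : 0 < τ2 - x := sub_pos.2 h2
    have e1 : 1 - (x - τ1) / (τ2 - τ1) = (τ2 - x) / (τ2 - τ1) := by
      field_simp; ring
    have p1 : 0 < (x - τ1) / (τ2 - τ1) := div_pos ha hL
    have p2 : 0 < (τ2 - x) / (τ2 - τ1) := div_pos hb hL
    unfold Real.smoothTransition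
    rw [e1]
    simp only [expNegInvGlue, not_le.2 p1, not_le.2 p2, if_false, inv_div]
    rw [Real.exp_sub, Real.exp_neg, Real.exp_neg]
    have := Real.exp_pos ((τ2 - τ1) / (x - τ1))
    have := Real.exp_pos ((τ2 - τ1) / (τ2 - x))
    field_simp
    try ring
  · rw [Real.smoothTransition.one_of_one_le]
    · ring
    · rw [le_div_iff₀ hL]; linarith

lemma theta_contDiff (τ1 τ2 v1 v2 : ℝ) (hτ : τ1 < τ2) :
    ContDiff ℝ (⊤ : ℕ∞) (theta τ1 τ2 v1 v2) := by
  have : theta τ1 τ2 v1 v2 = fun x =>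
      v1 + (v2 - v1) * Real.smoothTransition ((x - τ1) / (τ2 - τ1)) :=
    funext (theta_eq τ1 τ2 v1 v2 hτ)
  rw [this]
  refine contDiff_const.add (contDiff_const.mul ?_)
  exact Real.smoothTransition.contDiff.comp
    ((contDiff_id.sub contDiff_const).div_const _)

lemma iteratedDeriv_zero_of_eqOn (f : ℝ → ℝ) (c : ℝ) (s : Set ℝ) (hs : IsOpen s)
    (hf : ContDiff ℝ (⊤ : ℕ∞) f) (h : ∀ x ∈ s, f x = c) (k : ℕ) (hk : 1 ≤ k) :
    ∀ x ∈ closure s, iteratedDeriv k f x = 0 := by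
  have hc : Continuous (iteratedDeriv k f) :=
    hf.continuous_iteratedDeriv k (by exact_mod_cast le_top)
  have hcl : IsClosed {x | iteratedDeriv k f x = 0} := isClosed_eq hc continuous_const
  refine fun x hx => closure_minimal (fun y hy => ?_) hcl hx
  have hev : f =ᶠ[nhds y] fun _ => c := by
    filter_upwards [hs.mem_nhds hy] with z hz using h z hz
  have := hev.iteratedDeriv_eq k
  simp only [Set.mem_ofPred_eq]
  rw [this, iteratedDeriv_const]
  simp; omega

lemma theta_iter (τ1 τ2 v1 v2 : ℝ) (hτ : τ1 < τ2) (k : ℕ) (hk : 1 ≤ k) (x : ℝ)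
    (hx : x ∉ Set.Ioo τ1 τ2) : iteratedDeriv k (theta τ1 τ2 v1 v2) x = 0 := by
  have hf := theta_contDiff τ1 τ2 v1 v2 hτ
  rcases le_or_gt x τ1 with h | h
  · refine iteratedDeriv_zero_of_eqOn _ v1 (Set.Iio τ1) isOpen_Iio hf ?_ k hk x ?_
    · intro y hy
      have : y ≤ τ1 := le_of_lt hy
      simp [theta, this]
    · rw [closure_Iio]; exact h
  · have h2 : τ2 ≤ x := by
      by_contra h3
      exact hx ⟨h, not_le.1 h3⟩
    refine iteratedDeriv_zero_of_eqOn _ v2 (Set.Ioi τ2) isOpen_Ioi hf ?_ k hk x ?_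
    · intro y hy
      have hy' : τ2 < y := hy
      simp [theta, not_le.2 (hτ.trans hy'), not_lt.2 hy'.le]
    · rw [closure_Ioi]; exact h2

lemma theta_deriv (τ1 τ2 v1 v2 : ℝ) (x : ℝ) (h1 : τ1 < x) (h2 : x < τ2) :
    deriv (theta τ1 τ2 v1 v2) x =
      (v2 - v1) / (τ2 - τ1) *
      (Real.exp ((τ2 - τ1) / (x - τ1) - (τ2 - τ1) / (τ2 - x)) *
        (((τ2 - τ1) / (x - τ1)) ^ 2 + ((τ2 - τ1) / (τ2 - x)) ^ 2) /
      (1 + Real.exp ((τ2 - τ1) / (x - τ1) - (τ2 - τ1) / (τ2 - x))) ^ 2) := by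
  have ha : x - τ1 ≠ 0 := (sub_pos.2 h1).ne'
  have hb : τ2 - x ≠ 0 := (sub_pos.2 h2).ne'
  have hL : τ2 - τ1 ≠ 0 := (sub_pos.2 (h1.trans h2)).ne'
  have hev : theta τ1 τ2 v1 v2 =ᶠ[nhds x] fun x =>
      v1 + (v2 - v1) / (1 + Real.exp ((τ2 - τ1) / (x - τ1) - (τ2 - τ1) / (τ2 - x))) := by
    filter_upwards [Ioo_mem_nhds h1 h2] with z hz
    simp [theta, not_le.2 hz.1, hz.2]
  rw [hev.deriv_eq]
  have d1 := (hasDerivAt_const x (τ2 - τ1)).div ((hasDerivAt_id x).sub_const τ1) ha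
  have d2 := (hasDerivAt_const x (τ2 - τ1)).div ((hasDerivAt_id x).const_sub τ2) hb
  have hpos : 1 + Real.exp ((τ2 - τ1) / (x - τ1) - (τ2 - τ1) / (τ2 - x)) ≠ 0 := by positivity
  have d3 := (((hasDerivAt_const x (v2 - v1)).div ((d1.sub d2).exp.const_add 1) hpos).const_add v1)
  refine (HasDerivAt.deriv d3).trans ?_
  simp only [id, Pi.div_apply, Pi.sub_apply]
  generalize Real.exp ((τ2 - τ1) / (x - τ1) - (τ2 - τ1) / (τ2 - x)) = E at *
  field_simp
  ring

lemma key_bound (a b : ℝ) (ha : 0 < a) (hb : 0 < b) (hab : a * b = a + b) :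
    Real.exp (a - b) * (a ^ 2 + b ^ 2) / (1 + Real.exp (a - b)) ^ 2 ≤ 4 := by
  have hE := Real.exp_pos (a - b)
  have hEE : Real.exp (a - b) * Real.exp (-(a - b)) = 1 := by
    rw [← Real.exp_add]; simp
  have hs : 2 + (a - b) ^ 2 / 2 ≤ Real.exp (a - b) + Real.exp (-(a - b)) := by
    rcases le_total 0 (a - b) with h | h
    · have := Real.quadratic_le_exp_of_nonneg h
      have := Real.add_one_le_exp (-(a - b))
      linarith
    · have := Real.quadratic_le_exp_of_nonneg (neg_nonneg.2 h)
      have := Real.add_one_le_exp (a - b)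
      nlinarith
  have hp : (a * b) ^ 2 = (a - b) ^ 2 + 4 * (a * b) := by
    nth_rewrite 1 [hab]; ring
  have hm : a ^ 2 + b ^ 2 ≤ 4 * (2 + (Real.exp (a - b) + Real.exp (-(a - b)))) := by
    nlinarith [sq_nonneg (a * b - 3)]
  rw [div_le_iff₀ (by positivity)]
  have := mul_le_mul_of_nonneg_left hm hE.le
  nlinarith

theorem statement16 (τ1 τ2 v1 v2 : ℝ) (hτ : τ1 < τ2) (hv : v1 < v2) :
    ContDiff ℝ (⊤ : ℕ∞) (theta τ1 τ2 v1 v2) ∧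
    (∀ x, theta τ1 τ2 v1 v2 x ∈ Set.Icc v1 v2) ∧
    (∀ k : ℕ, 1 ≤ k → ∀ x ∉ Set.Ioo τ1 τ2, iteratedDeriv k (theta τ1 τ2 v1 v2) x = 0) ∧
    StrictMonoOn (theta τ1 τ2 v1 v2) (Set.Icc τ1 τ2) ∧
    (∀ x, |deriv (theta τ1 τ2 v1 v2) x| ≤ 4 * (v2 - v1) / (τ2 - τ1)) := by
  have hL : 0 < τ2 - τ1 := sub_pos.2 hτ
  have hV : 0 < v2 - v1 := sub_pos.2 hv
  have hf := theta_contDiff τ1 τ2 v1 v2 hτ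
  have hpos : ∀ x ∈ Set.Ioo τ1 τ2, 0 < deriv (theta τ1 τ2 v1 v2) x := by
    rintro x ⟨h1, h2⟩
    rw [theta_deriv τ1 τ2 v1 v2 x h1 h2]
    have ha : 0 < x - τ1 := sub_pos.2 h1
    have hb : 0 < τ2 - x := sub_pos.2 h2
    positivity
  refine ⟨hf, ?_, theta_iter τ1 τ2 v1 v2 hτ, ?_, ?_⟩
  · intro x
    rw [theta_eq τ1 τ2 v1 v2 hτ]
    have h0 := Real.smoothTransition.nonneg ((x - τ1) / (τ2 - τ1))
    have h1 := Real.smoothTransition.le_one ((x - τ1) / (τ2 - τ1))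
    constructor <;> nlinarith
  · refine strictMonoOn_of_deriv_pos (convex_Icc _ _) hf.continuous.continuousOn ?_
    rw [interior_Icc]
    exact hpos
  · intro x
    by_cases hx : x ∈ Set.Ioo τ1 τ2
    · rw [abs_of_pos (hpos x hx), theta_deriv τ1 τ2 v1 v2 x hx.1 hx.2]
      have ha : 0 < x - τ1 := sub_pos.2 hx.1
      have hb : 0 < τ2 - x := sub_pos.2 hx.2
      have := key_bound ((τ2 - τ1) / (x - τ1)) ((τ2 - τ1) / (τ2 - x))
        (by positivity) (by positivity) (by field_simp; ring)
      calc _ ≤ (v2 - v1) / (τ2 - τ1) * 4 := mul_le_mul_of_nonneg_left this (by positivity)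
        _ = _ := by ring
    · have := theta_iter τ1 τ2 v1 v2 hτ 1 le_rfl x hx
      rw [iteratedDeriv_one] at this
      rw [this, abs_zero]
      positivity
end
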